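/- Let m ∈ ℕ and let p ∈ P_m. Then there exists a polynomial q ∈ ℝ[x,y,t], every monomial of which has weighted degree at most m − 2 (so q = 0 when m ≤ 1), such that Δ_H((1 − η₊²)·q) = −Δ_H p as an identity of polynomials. -/

import Mathlib

open MvPolynomial

noncomputable section

/-- The polynomial ring ℝ[x,y,t], with x = X 0, y = X 1, t = X 2. -/
abbrev R3 := MvPolynomial (Fin 3) ℝ

/-- The weights w(x) = w(y) = 1, w(t) = 2. -/
def w3 : Fin 3 → ℤ := ![1, 1, 2]

/-- The horizontal vector field X p = ∂ₓ p + 2 y ∂ₜ p. -/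
def Xop : R3 →ₗ[ℝ] R3 :=
  (pderiv (0 : Fin 3)).toLinearMap +
    (LinearMap.mulLeft ℝ ((2 : R3) * X 1)) ∘ₗ (pderiv (2 : Fin 3)).toLinearMap

/-- The horizontal vector field Y p = ∂_y p − 2 x ∂ₜ p. -/
def Yop : R3 →ₗ[ℝ] R3 :=
  (pderiv (1 : Fin 3)).toLinearMap -
    (LinearMap.mulLeft ℝ ((2 : R3) * X 0)) ∘ₗ (pderiv (2 : Fin 3)).toLinearMap

/-- The Heisenberg sub-Laplacian Δ_H = X² + Y². -/
def ΔH : R3 →ₗ[ℝ] R3 := Xop ∘ₗ Xop + Yop ∘ₗ Yop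

/-- P_m : weighted homogeneous polynomials of degree m (ℤ-indexed, so P_m = 0 for m < 0). -/
def Pm (m : ℤ) : Submodule ℝ R3 := weightedHomogeneousSubmodule ℝ w3 m

/-- H_m : weighted homogeneous Δ_H-harmonic polynomials of degree m. -/
def Hm (m : ℤ) : Submodule ℝ R3 := Pm m ⊓ LinearMap.ker ΔH

/-- The polynomial gauge η₊² = x² + y² + 4t. -/
def etaSq : R3 := X 0 ^ 2 + X 1 ^ 2 + 4 * X 2

/-! sequence part -/
lemma ek_norm (p : ℕ → ℝ) (j : ℕ) (h0 : 0 < p 0) (hp : ∀ a < j, p a < p (a+1)) (u : ℂ)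
    (hu : ‖u‖ = 1) (hu1 : u ≠ 1) : ∑ a ∈ Finset.range (j+1), (p a : ℂ) * u ^ a ≠ 0 := by
  have key : ∀ n, n + 1 ≤ j →
      ‖(∑ a ∈ Finset.range (n+2), (p a : ℂ) * u ^ a) * (1 - u) + p (n+1) * u ^ (n+2)‖ < p (n+1) := by
    intro n
    induction n with
    | zero =>
      intro hn
      have h1 := hp 0 (by omega)
      have e : (∑ a ∈ Finset.range (0+2), (p a : ℂ) * u ^ a) * (1 - u) + p (0+1) * u ^ (0+2)
          = (p 0 : ℂ) + ((p 1 - p 0 : ℝ) : ℂ) * u := by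
        simp [Finset.sum_range_succ]; ring
      rw [e]
      simp only [zero_add] at *
      have hsq : u.re ^ 2 + u.im ^ 2 = 1 := by
        have := Complex.sq_norm u
        rw [hu, Complex.normSq_apply] at this; linarith
      have hre : u.re < 1 := by
        by_contra hc
        push Not at hc
        have him : u.im = 0 := by nlinarith [sq_nonneg u.im]
        apply hu1
        apply Complex.ext
        · simp; nlinarith
        · simpa using him
      have hn2 : ‖(p 0 : ℂ) + ((p 1 - p 0 : ℝ) : ℂ) * u‖ ^ 2 < p 1 ^ 2 := by
        rw [Complex.sq_norm, Complex.normSq_apply]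
        simp only [Complex.add_re, Complex.add_im, Complex.mul_re, Complex.mul_im,
          Complex.ofReal_re, Complex.ofReal_im]
        have : 0 < p 0 * (p 1 - p 0) * (1 - u.re) := by
          apply mul_pos (mul_pos h0 (by linarith)) (by linarith)
        have h5 : (u.re ^ 2 + u.im ^ 2) * (p 1 - p 0)^2 = 1 * (p 1 - p 0)^2 := by rw [hsq]
        nlinarith
      exact lt_of_pow_lt_pow_left₀ 2 (by linarith) hn2
    | succ n ih =>
      intro hn
      have h1 := ih (by omega)
      have h2 := hp (n+1) (by omega)
      have e : (∑ a ∈ Finset.range (n+1+2), (p a : ℂ) * u ^ a) * (1 - u) + p (n+1+1) * u ^ (n+1+2)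
        = ((∑ a ∈ Finset.range (n+2), (p a : ℂ) * u ^ a) * (1 - u) + p (n+1) * u ^ (n+2))
          + ((p (n+1+1) - p (n+1) : ℝ) : ℂ) * u ^ (n+2) := by
        rw [show n+1+2 = (n+2)+1 by ring, Finset.sum_range_succ]
        push_cast; ring
      rw [e]
      have h3 : ‖((p (n+1+1) - p (n+1) : ℝ) : ℂ) * u ^ (n+2)‖ = p (n+1+1) - p (n+1) := by
        rw [norm_mul, norm_pow, hu, one_pow, mul_one, Complex.norm_real, Real.norm_eq_abs,
          abs_of_pos (by linarith)]
      have := norm_add_le ((∑ a ∈ Finset.range (n+2), (p a : ℂ) * u ^ a) * (1 - u) + p (n+1) * u ^ (n+2))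
        (((p (n+1+1) - p (n+1) : ℝ) : ℂ) * u ^ (n+2))
      linarith
  intro hS
  rcases j with _ | n
  · simp at hS; exact h0.ne' hS
  · have h1 := key n le_rfl
    rw [hS, zero_mul, zero_add, norm_mul, norm_pow, hu, one_pow, mul_one, Complex.norm_real,
      Real.norm_eq_abs] at h1
    exact absurd (le_abs_self _) (not_le.mpr h1)

noncomputable def pc (k j : ℕ) (a : ℕ) : ℝ :=
  ∏ i ∈ Finset.range a, (((j:ℝ) - i) * (i + k + 1/2) / ((i + 1) * (j - i - 1/2)))

lemma pc_succ (k j a : ℕ) :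
    pc k j (a+1) * ((a + 1) * ((j:ℝ) - a - 1/2)) = pc k j a * (((j:ℝ) - a) * (a + k + 1/2)) := by
  have h : ((a:ℝ) + 1) * ((j:ℝ) - a - 1/2) ≠ 0 := by
    apply mul_ne_zero (by positivity)
    intro h
    have : (2 * (j:ℝ)) = 2 * a + 1 := by linarith
    have : 2 * j = 2 * a + 1 := by exact_mod_cast this
    omega
  rw [pc, Finset.prod_range_succ, ← pc, mul_assoc, div_mul_cancel₀ _ h]

lemma pc_pos (k j : ℕ) (a : ℕ) (h : a ≤ j) : 0 < pc k j a := by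
  apply Finset.prod_pos
  intro i hi
  have hi := Finset.mem_range.mp hi
  have : (i:ℝ) + 1 ≤ j := by exact_mod_cast (by omega : i + 1 ≤ j)
  apply div_pos
  · apply mul_pos (by linarith) (by positivity)
  · apply mul_pos (by positivity) (by linarith)

lemma pc_lt (k j : ℕ) (hk : 1 ≤ k) (a : ℕ) (h : a < j) : pc k j a < pc k j (a+1) := by
  have h0 := pc_pos k j a h.le
  have h1 := pc_succ k j a
  have : (a:ℝ) + 1 ≤ j := by exact_mod_cast h
  have hk : (1:ℝ) ≤ k := by exact_mod_cast hk
  have hd : 0 < ((a:ℝ) + 1) * ((j:ℝ) - a - 1/2) := mul_pos (by positivity) (by linarith)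
  have : ((a:ℝ) + 1) * ((j:ℝ) - a - 1/2) < (((j:ℝ) - a) * (a + k + 1/2)) := by nlinarith
  have := mul_lt_mul_of_pos_left this h0
  rw [← h1] at this
  exact lt_of_mul_lt_mul_right this hd.le

section psi
open Polynomial
noncomputable def PA : ℂ[X] := 1 + Polynomial.C Complex.I * Polynomial.X
noncomputable def PB : ℂ[X] := 1 - Polynomial.C Complex.I * Polynomial.X
noncomputable def psi (k j : ℕ) : ℂ[X] :=
  ∑ a ∈ Finset.range (j+1), Polynomial.C (pc k j a : ℂ) * (PA ^ a * PB ^ (j - a))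

noncomputable def Lop (k j : ℕ) (f : ℂ[X]) : ℂ[X] :=
  Polynomial.X * (1 + Polynomial.X^2) * derivative (derivative f) +
   (((k : Polynomial ℂ) + 1) - 2 * ((j:ℂ[X]) - 1) * Polynomial.X^2 + Polynomial.C Complex.I * (k : Polynomial ℂ) * Polynomial.X)
     * derivative f
   + ((j:ℂ[X]) * ((j : Polynomial ℂ) - 1) * Polynomial.X - Polynomial.C Complex.I * (k : Polynomial ℂ) * (j : Polynomial ℂ)) * f

lemma CI2 : (Polynomial.C Complex.I : ℂ[X])^2 = -1 := by
  rw [← Polynomial.C_pow, Complex.I_sq]; simp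

lemma derPA : derivative PA = Polynomial.C Complex.I := by simp [PA]
lemma derPB : derivative PB = -Polynomial.C Complex.I := by simp [PB]

lemma PA_ne : PA ≠ 0 := by
  intro h; have := congrArg (Polynomial.eval 0) h; simp [PA] at this
lemma PB_ne : PB ≠ 0 := by
  intro h; have := congrArg (Polynomial.eval 0) h; simp [PB] at this

lemma pow_der (f : ℂ[X]) (a : ℕ) : f * derivative (f ^ a) = (a:ℂ[X]) * derivative f * f ^ a := by
  rcases a with _ | a
  · simp
  · rw [Polynomial.derivative_pow_succ]; simp; ring

lemma L_key {R : Type*} [CommRing R] (i x a b k : R) (hI : i^2 = -1) (A B : R)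
    (hA : A = 1 + i * x) (hB : B = 1 - i * x) :
    x * (A * B * (a + b) + (i * (a * B - b * A) - 2 * x) * (i * (a * B - b * A)))
      + (k + 1 - 2 * (a + b - 1) * x^2 + i * k * x) * (i * (a * B - b * A))
      + ((a + b) * (a + b - 1) * x - i * k * (a + b)) * (A * B)
      = - i * (b * (2 * a + 2 * k + 1) * A - a * (2 * b + 1) * B) := by
  subst hA hB
  grind

lemma L_T (k a b : ℕ) : PA * PB * Lop k (a+b) (PA ^ a * PB ^ b) =
    - Polynomial.C Complex.I * ((b:ℂ[X]) * (2 * a + 2 * k + 1) * PA - a * (2 * b + 1) * PB) *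
      (PA ^ a * PB ^ b) := by
  set T := PA ^ a * PB ^ b with hT
  have h1 : PA * PB * derivative T = Polynomial.C Complex.I * ((a:ℂ[X]) * PB - b * PA) * T := by
    rw [hT, Polynomial.derivative_mul]
    have ha := pow_der PA a
    have hb := pow_der PB b
    rw [derPA] at ha
    rw [derPB] at hb
    linear_combination PB * PB ^ b * ha + PA * PA ^ a * hb
  have h2 := congrArg derivative h1
  simp only [Polynomial.derivative_mul, Polynomial.derivative_sub, derPA, derPB,
    Polynomial.derivative_C, Polynomial.derivative_natCast] at h2
  have hAB : PA * PB = 1 + Polynomial.X^2 := by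
    rw [PA, PB]; linear_combination (-Polynomial.X^2) * CI2
  apply mul_left_cancel₀ (mul_ne_zero PA_ne PB_ne)
  unfold Lop
  rw [← hAB]
  have hI := CI2
  push_cast
  have hA : PA = 1 + Polynomial.C Complex.I * Polynomial.X := rfl
  have hB : PB = 1 - Polynomial.C Complex.I * Polynomial.X := rfl
  have key := L_key (Polynomial.C Complex.I : ℂ[X]) Polynomial.X a b k hI PA PB hA hB
  have hc : Polynomial.C Complex.I * PB - PA * Polynomial.C Complex.I = 2 * Polynomial.X := by
    rw [hA, hB]; linear_combination (-2 * Polynomial.X) * hI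
  have hM : Polynomial.C Complex.I * ((a : ℂ[X]) * -Polynomial.C Complex.I - b * Polynomial.C Complex.I) = a + b := by
    linear_combination (-(a : ℂ[X]) - b) * hI
  linear_combination (Polynomial.X * (PA * PB)^2) * h2 +
    (Polynomial.X * (PA * PB) * (Polynomial.C Complex.I * ((a:ℂ[X]) * PB - b * PA) - 2 * Polynomial.X)
     + PA * PB * (((k : Polynomial ℂ) + 1) - 2 * ((a : ℂ[X]) + b - 1) * Polynomial.X^2 + Polynomial.C Complex.I * (k : Polynomial ℂ) * Polynomial.X)) * h1
    + PA * PB * T * key - (Polynomial.X * (PA * PB)^2) * derivative T * hc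
    + (Polynomial.X * (PA * PB)^2) * T * hM

lemma PC2 : Polynomial.C (2:ℂ) = 2 := rfl

lemma Lop_add (k j : ℕ) (f g : ℂ[X]) : Lop k j (f + g) = Lop k j f + Lop k j g := by
  simp only [Lop, Polynomial.derivative_add]; ring

lemma Lop_C (k j : ℕ) (c : ℂ) (f : ℂ[X]) :
    Lop k j (Polynomial.C c * f) = Polynomial.C c * Lop k j f := by
  simp only [Lop, Polynomial.derivative_C_mul]; ring

lemma Lop_sum (k j : ℕ) (s : Finset ℕ) (f : ℕ → ℂ[X]) :
    Lop k j (∑ a ∈ s, f a) = ∑ a ∈ s, Lop k j (f a) := by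
  classical
  induction s using Finset.induction_on with
  | empty => simp [Lop]
  | insert a s ha ih => rw [Finset.sum_insert ha, Finset.sum_insert ha, Lop_add, ih]

lemma Lop_psi (k j : ℕ) : Lop k j (psi k j) = 0 := by
  apply mul_left_cancel₀ (mul_ne_zero PA_ne PB_ne)
  rw [psi, Lop_sum, mul_zero, Finset.mul_sum]
  have h1 : ∀ a ∈ Finset.range (j+1),
      PA * PB * Lop k j (Polynomial.C (pc k j a : ℂ) * (PA ^ a * PB ^ (j - a))) =
      - Polynomial.C Complex.I * (
        Polynomial.C ((pc k j a * ((j - a) * (2 * a + 2 * k + 1)) : ℝ) : ℂ) * PA ^ (a+1) * PB ^ (j - a)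
        - Polynomial.C ((pc k j a * (a * (2 * (j - a) + 1)) : ℝ) : ℂ) * PA ^ a * PB ^ (j + 1 - a)) := by
    intro a ha
    obtain ⟨b, rfl⟩ := Nat.exists_eq_add_of_le (Nat.lt_succ_iff.mp (Finset.mem_range.mp ha))
    rw [Lop_C, show a + b - a = b by omega, show a + b + 1 - a = b + 1 by omega]
    have := L_T k a b
    have e1 : Polynomial.C ((pc k (a+b) a * (((a+b : ℕ) - a) * (2 * a + 2 * k + 1)) : ℝ) : ℂ) =
      Polynomial.C (pc k (a+b) a : ℂ) * ((b:ℂ[X]) * (2 * a + 2 * k + 1)) := by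
      push_cast; simp [PC2]
    have e2 : Polynomial.C ((pc k (a+b) a * (a * (2 * ((a+b : ℕ) - a) + 1)) : ℝ) : ℂ) =
      Polynomial.C (pc k (a+b) a : ℂ) * ((a:ℂ[X]) * (2 * b + 1)) := by
      push_cast; simp [PC2]
    rw [e1, e2]
    linear_combination Polynomial.C (pc k (a+b) a : ℂ) * this
  rw [Finset.sum_congr rfl h1, ← Finset.mul_sum, Finset.sum_sub_distrib]
  rw [Finset.sum_range_succ, Finset.sum_range_succ' (n := j)]
  have h2 : ∀ a ∈ Finset.range j,
      Polynomial.C ((pc k j a * ((j - a) * (2 * a + 2 * k + 1)) : ℝ) : ℂ) * PA ^ (a+1) * PB ^ (j - a)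
      = Polynomial.C ((pc k j (a+1) * ((a+1 : ℕ) * (2 * (j - (a+1 : ℕ)) + 1)) : ℝ) : ℂ) * PA ^ (a+1) * PB ^ (j + 1 - (a+1)) := by
    intro a ha
    have h := pc_succ k j a
    rw [Nat.add_sub_add_right]
    congr 4
    push_cast
    linarith
  rw [Finset.sum_congr rfl h2]
  simp

lemma psi_rec (k j n : ℕ) :
    ((n:ℂ)+2) * (k + n + 2) * (psi k j).coeff (n+2) - Complex.I * k * (j - n - 1) * (psi k j).coeff (n+1)
      + (j - n) * (j - n - 1) * (psi k j).coeff n = 0 := by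
  have h := congrArg (fun f => Polynomial.coeff f (n+1)) (Lop_psi k j)
  generalize psi k j = f at *
  have e : Lop k j f = Polynomial.X * derivative (derivative f)
    + Polynomial.X * (Polynomial.X * (Polynomial.X * derivative (derivative f)))
    + Polynomial.C ((k:ℂ) + 1) * derivative f
    - Polynomial.C (2 * ((j:ℂ) - 1)) * (Polynomial.X * (Polynomial.X * derivative f))
    + Polynomial.C (Complex.I * k) * (Polynomial.X * derivative f)
    + Polynomial.C ((j:ℂ) * (j - 1)) * (Polynomial.X * f)
    - Polynomial.C (Complex.I * k * j) * f := by
    simp [Lop, PC2]; ring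
  rw [e] at h
  rcases n with _ | _ | n <;>
  · simp only [Polynomial.coeff_add, Polynomial.coeff_sub, Polynomial.coeff_C_mul, Polynomial.coeff_X_mul,
      Polynomial.coeff_X_mul_zero, zero_add, Polynomial.coeff_derivative, Polynomial.coeff_zero] at h
    push_cast at h ⊢
    linear_combination h

lemma psi_rec0 (k j : ℕ) :
    ((k : ℂ) + 1) * (psi k j).coeff 1 - Complex.I * k * j * (psi k j).coeff 0 = 0 := by
  have h := congrArg (fun f => Polynomial.coeff f 0) (Lop_psi k j)
  generalize psi k j = f at *
  have e : Lop k j f = Polynomial.X * ((1 + Polynomial.X^2) * derivative (derivative f))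
    + Polynomial.C ((k:ℂ) + 1) * derivative f
    - Polynomial.X * (Polynomial.C (2 * ((j:ℂ) - 1)) * ((Polynomial.X * derivative f)))
    + Polynomial.X * (Polynomial.C (Complex.I * k) * (derivative f))
    + Polynomial.X * (Polynomial.C ((j:ℂ) * (j - 1)) * (f))
    - Polynomial.C (Complex.I * k * j) * f := by
    simp [Lop, PC2]; ring
  rw [e] at h
  simp only [Polynomial.coeff_add, Polynomial.coeff_sub, Polynomial.coeff_C_mul, Polynomial.coeff_X_mul,
      Polynomial.coeff_X_mul_zero, zero_add, Polynomial.coeff_derivative, Polynomial.coeff_zero] at h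
  push_cast at h
  linear_combination h

lemma psi_zero (k j : ℕ) : (psi k j).coeff 0 ≠ 0 := by
  rw [Polynomial.coeff_zero_eq_eval_zero, psi, Polynomial.eval_finsetSum]
  simp only [PA, PB, Polynomial.eval_mul, Polynomial.eval_C, Polynomial.eval_pow, Polynomial.eval_add,
    Polynomial.eval_sub, Polynomial.eval_one, Polynomial.eval_X, mul_zero, add_zero, sub_zero, one_pow, mul_one]
  rw [← Complex.ofReal_sum]
  norm_cast
  apply ne_of_gt
  apply Finset.sum_pos
  · intro a ha; exact pc_pos k j a (Nat.lt_succ_iff.mp (Finset.mem_range.mp ha))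
  · simp

lemma psi_natDegree (k j : ℕ) : (psi k j).natDegree ≤ j := by
  apply Polynomial.natDegree_sum_le_of_forall_le
  intro a ha
  have ha := Finset.mem_range.mp ha
  refine (Polynomial.natDegree_C_mul_le _ _).trans ?_
  refine Polynomial.natDegree_mul_le.trans ?_
  have h1 : PA.natDegree ≤ 1 := by unfold PA; compute_degree
  have h2 : PB.natDegree ≤ 1 := by unfold PB; compute_degree
  have := Polynomial.natDegree_pow_le_of_le a h1
  have := Polynomial.natDegree_pow_le_of_le (j-a) h2
  omega

lemma psi_eval (k j : ℕ) (hk : 1 ≤ k) : (psi k j).eval (-4) ≠ 0 := by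
  have hB : (1 + 4 * Complex.I) ≠ 0 := by
    intro h; have := congrArg Complex.re h; simp at this
  have e : (psi k j).eval (-4) = (1 + 4 * Complex.I) ^ j *
      ∑ a ∈ Finset.range (j+1), (pc k j a : ℂ) * ((1 - 4 * Complex.I) / (1 + 4 * Complex.I)) ^ a := by
    rw [psi, Polynomial.eval_finsetSum, Finset.mul_sum]
    apply Finset.sum_congr rfl
    intro a ha
    obtain ⟨b, rfl⟩ := Nat.exists_eq_add_of_le (Nat.lt_succ_iff.mp (Finset.mem_range.mp ha))
    simp only [PA, PB, Polynomial.eval_mul, Polynomial.eval_C, Polynomial.eval_pow, Polynomial.eval_add,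
      Polynomial.eval_sub, Polynomial.eval_one, Polynomial.eval_X]
    rw [show a + b - a = b by omega, pow_add, div_pow, show (1 + Complex.I * (-4)) = 1 - 4 * Complex.I by ring,
      show (1 - Complex.I * (-4)) = 1 + 4 * Complex.I by ring]
    field_simp
  rw [e]
  apply mul_ne_zero (pow_ne_zero _ hB)
  apply ek_norm _ _ (pc_pos k j 0 (by omega)) (fun a ha => pc_lt k j hk a ha)
  · rw [norm_div]
    have : (1 - 4 * Complex.I) = (starRingEnd ℂ) (1 + 4 * Complex.I) := by
      simp [Complex.ext_iff]
    rw [this, Complex.norm_conj, div_self]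
    simpa using hB
  · intro h
    rw [div_eq_one_iff_eq hB] at h
    have := congrArg Complex.im h
    norm_num at this
end psi

/-- nonvanishing for k ≥ 1 -/
lemma seq_pos (k j : ℕ) (hk : 1 ≤ k) (f : ℕ → ℂ)
    (h0 : ((k : ℂ) + 1) * f 1 - Complex.I * k * j * f 0 = 0)
    (hr : ∀ n, n + 2 ≤ j → ((n:ℂ)+2) * (k + n + 2) * f (n+2) - Complex.I * k * (j - n - 1) * f (n+1)
      + (j - n) * (j - n - 1) * f n = 0)
    (hs : ∑ n ∈ Finset.range (j+1), f n * (-4)^n = 0) : f 0 = 0 := by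
  have key : ∀ n, n ≤ j → f n * (psi k j).coeff 0 = f 0 * (psi k j).coeff n := by
    intro n
    induction n using Nat.strong_induction_on with
    | _ n ih =>
      intro hn
      rcases n with _ | _ | n
      · rfl
      · have hk' : (k:ℂ) + 1 ≠ 0 := by exact_mod_cast (by omega : k + 1 ≠ 0)
        apply mul_left_cancel₀ hk'
        simp only [zero_add]
        linear_combination (psi k j).coeff 0 * h0 - f 0 * psi_rec0 k j
      · have hk' : ((n:ℂ)+2) * (k + n + 2) ≠ 0 := by
          exact_mod_cast (by positivity : (n+2) * (k + n + 2) ≠ 0)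
        have i1 := ih n (by omega) (by omega)
        have i2 := ih (n+1) (by omega) (by omega)
        apply mul_left_cancel₀ hk'
        linear_combination (psi k j).coeff 0 * hr n hn - f 0 * psi_rec k j n +
          Complex.I * k * (j - n - 1) * i2 - (j - n) * (j - n - 1) * i1
  have : f 0 * (psi k j).eval (-4) = 0 := by
    rw [Polynomial.eval_eq_sum_range' (Nat.lt_succ_of_le (psi_natDegree k j)), Finset.mul_sum]
    have : (∑ n ∈ Finset.range (j+1), f n * (-4)^n) * (psi k j).coeff 0 = 0 := by rw [hs, zero_mul]
    rw [Finset.sum_mul] at this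
    rw [← this]
    apply Finset.sum_congr rfl
    intro n hn
    linear_combination -(-4)^n * key n (Nat.lt_succ_iff.mp (Finset.mem_range.mp hn))
  exact (mul_eq_zero.mp this).resolve_right (psi_eval k j hk)

lemma seq_zero (j : ℕ) (f : ℕ → ℂ)
    (h0 : f 1 = 0)
    (hr : ∀ n, n + 2 ≤ j → ((n:ℂ)+2) * (n + 2) * f (n+2) 
      + (j - n) * (j - n - 1) * f n = 0)
    (hs : ∑ n ∈ Finset.range (j+1), f n * (-4)^n = 0) : f 0 = 0 := by
  have key : ∀ n, n ≤ j → ∃ z : ℤ, f n * (-4)^n = f 0 * z ∧ (1 ≤ n → (2:ℤ) ∣ z) := by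
    have hodd : ∀ b, 2 * b + 1 ≤ j → f (2*b+1) = 0 := by
      intro b
      induction b with
      | zero => intro _; exact h0
      | succ b ih =>
        intro hb
        have := hr (2*b+1) (by omega)
        rw [ih (by omega), mul_zero, add_zero] at this
        refine (mul_eq_zero.mp this).resolve_left ?_
        exact_mod_cast (by positivity : (2*b+1+2) * (2*b+1+2) ≠ 0)
    have heven : ∀ b, 2 * b ≤ j → f (2*b) * 4^b = f 0 * ((-1)^b * (Nat.centralBinom b * j.choose (2*b) : ℕ)) := by
      intro b
      induction b with
      | zero => intro _; simp
      | succ b ih =>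
        intro hb
        have h1 := hr (2*b) (by omega)
        have h2 := ih (by omega)
        have c1 : ((b:ℂ) + 1) * (Nat.centralBinom (b+1) : ℂ) = 2 * (2 * b + 1) * Nat.centralBinom b := by
          exact_mod_cast Nat.succ_mul_centralBinom_succ b
        have c2 : (j.choose (2*b+1) : ℂ) * (2 * b + 1) = j.choose (2*b) * (j - 2 * b) := by
          have := Nat.choose_succ_right_eq j (2*b)
          have := congrArg (Nat.cast (R := ℂ)) this
          rw [Nat.cast_mul, Nat.cast_mul, Nat.cast_sub (by omega)] at this
          push_cast at this
          exact this
        have c3 : (j.choose (2*b+2) : ℂ) * (2 * b + 2) = j.choose (2*b+1) * (j - 2 * b - 1) := by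
          have := Nat.choose_succ_right_eq j (2*b+1)
          have := congrArg (Nat.cast (R := ℂ)) this
          rw [Nat.cast_mul, Nat.cast_mul, Nat.cast_sub (by omega)] at this
          push_cast at this
          linear_combination this
        have hb1 : ((b:ℂ)+1) ≠ 0 := by exact_mod_cast (by omega : b + 1 ≠ 0)
        have hb2 : ((2*b:ℂ)+1) ≠ 0 := by exact_mod_cast (by omega : 2*b + 1 ≠ 0)
        rw [show 2 * (b+1) = 2*b+2 by ring]
        push_cast at h1 h2 ⊢
        apply mul_left_cancel₀ (mul_ne_zero (mul_ne_zero hb1 hb1) hb2)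
        have e : ((b:ℂ)+1) * (b+1) * (2*b+1) * (Nat.centralBinom (b+1) * j.choose (2*b+2)) =
           (2*b+1) * Nat.centralBinom b * j.choose (2*b) * (j - 2*b) * (j - 2*b-1) := by
          linear_combination (b+1) * (2*b+1) * (j.choose (2*b+2) : ℂ) * c1 +
            (2*b+1) * (2*b+1) * (Nat.centralBinom b : ℂ) * c3 + (2*b+1) * (Nat.centralBinom b : ℂ) * (j - 2 * b - 1) * c2
        rw [pow_succ, pow_succ]
        linear_combination 4^b * (2*b+1) * h1 - (2*b+1) * (j - 2*b) * (j - 2*b-1) * h2 + f 0 * (-1)^b * e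
    intro n hn
    rcases Nat.even_or_odd' n with ⟨b, rfl | rfl⟩
    · refine ⟨4^b * (-1)^b * (Nat.centralBinom b * j.choose (2*b) : ℕ), ?_, ?_⟩
      · have := heven b hn
        push_cast at this ⊢
        rw [pow_mul, show ((-4:ℂ)^2)^b = 4^b * 4^b by rw [← mul_pow]; norm_num]
        linear_combination 4^b * this
      · intro hb
        rw [mul_assoc]
        apply Dvd.dvd.mul_right
        exact (by norm_num : (2:ℤ) ∣ 4).trans (dvd_pow_self _ (by omega))
    · exact ⟨0, by rw [hodd b hn]; simp, by simp⟩
  choose! z hz hz2 using key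
  rw [Finset.sum_congr rfl (fun n hn => hz n (Nat.lt_succ_iff.mp (Finset.mem_range.mp hn))),
    ← Finset.mul_sum, Finset.sum_range_succ'] at hs
  rcases mul_eq_zero.mp hs with h | h
  · exact h
  by_contra hf
  have hz0 : z 0 = 1 := by
    have := hz 0 (by omega)
    rw [pow_zero] at this
    exact_mod_cast (mul_left_cancel₀ hf this).symm
  rw [hz0] at h
  have h' : ∑ n ∈ Finset.range j, z (n+1) + 1 = 0 := by exact_mod_cast h
  have : (2:ℤ) ∣ ∑ n ∈ Finset.range j, z (n+1) :=
    Finset.dvd_sum (fun n hn => hz2 _ (by have := Finset.mem_range.mp hn; omega) (by omega))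
  omega

lemma seq_all (k j : ℕ) (f : ℕ → ℂ)
    (h0 : ((k : ℂ) + 1) * f 1 - Complex.I * k * j * f 0 = 0)
    (hr : ∀ n, n + 2 ≤ j → ((n:ℂ)+2) * (k + n + 2) * f (n+2) - Complex.I * k * (j - n - 1) * f (n+1)
      + (j - n) * (j - n - 1) * f n = 0)
    (hs : ∑ n ∈ Finset.range (j+1), f n * (-4)^n = 0) : ∀ n ≤ j, f n = 0 := by
  have hf0 : f 0 = 0 := by
    rcases Nat.eq_zero_or_pos k with rfl | hk
    · apply seq_zero j f (by simpa using h0) _ hs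
      intro n hn
      have := hr n hn
      push_cast at this
      linear_combination this
    · exact seq_pos k j hk f h0 hr hs
  intro n
  induction n using Nat.strong_induction_on with
  | _ n ih =>
    intro hn
    rcases n with _ | _ | n
    · exact hf0
    · have hk' : (k:ℂ) + 1 ≠ 0 := by exact_mod_cast (by omega : k + 1 ≠ 0)
      rw [hf0, mul_zero, sub_zero] at h0
      exact (mul_eq_zero.mp h0).resolve_left hk'
    · have hk' : ((n:ℂ)+2) * (k + n + 2) ≠ 0 := by
        exact_mod_cast (by positivity : (n+2) * (k + n + 2) ≠ 0)
      have := hr n hn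
      rw [ih n (by omega) (by omega), ih (n+1) (by omega) (by omega), mul_zero, mul_zero, sub_zero, add_zero] at this
      exact (mul_eq_zero.mp this).resolve_left hk'
def zwq (q : ℕ → ℕ → ℕ → ℂ) : ℕ → ℕ → ℕ → ℂ
  | a+1, b+1, c => q a b c
  | _, _, _ => 0

def ttq (q : ℕ → ℕ → ℕ → ℂ) : ℕ → ℕ → ℕ → ℂ
  | a, b, c+1 => q a b c
  | _, _, 0 => 0

noncomputable def gq (q : ℕ → ℕ → ℕ → ℂ) (a b c : ℕ) : ℂ := q a b c - zwq q a b c - 4 * ttq q a b c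

def shq (h : ℕ → ℂ) : ℕ → ℂ
  | 0 => 0
  | n+1 => h n

lemma core_ge (q : ℕ → ℕ → ℕ → ℂ)
    (hD : ∀ a b c : ℕ, ((a:ℂ)+1) * (b+1) * gq q (a+1) (b+1) c + (c+2) * (c+1) * zwq (gq q) a b (c+2)
      - Complex.I * (a - b) * (c+1) * gq q a b (c+1) = 0)
    (N : ℕ) (hN : ∀ a b c, N < a + b + 2 * c → q a b c = 0) (k n c : ℕ)
    (hn : k + n + n + 2 * c = N) : q (k+n) n c = 0 := by
  obtain ⟨J, hJ⟩ : ∃ J, J = n + c := ⟨_, rfl⟩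
  have hNJ : N = k + 2 * J := by omega
  set h : ℕ → ℂ := fun m => if m ≤ J then q (k+m) m (J-m) else 0 with hh
  set f : ℕ → ℂ := fun m => shq h m + 4 * h m with hf
  have hg : ∀ m c, m + c = J + 1 → gq q (k+m) m c = - f m := by
    intro m c hm
    have h1 : q (k+m) m c = 0 := hN _ _ _ (by omega)
    have h2 : zwq q (k+m) m c = shq h m := by
      rcases m with _ | m
      · rcases k with _ | k <;> rfl
      · show q (k+m) m c = h m
        simp only [hh]
        rw [if_pos (by omega), show J - m = c by omega]
    have h3 : ttq q (k+m) m c = h m := by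
      rcases c with _ | c
      · simp only [hh]; rw [if_neg (by omega)]; rfl
      · show q (k+m) m c = h m
        simp only [hh]
        rw [if_pos (by omega), show J - m = c by omega]
    simp only [gq, h1, h2, h3, hf]; ring
  have hs : ∀ M, ∑ n ∈ Finset.range (M+1), f n * (-4)^n = 4 * (-4)^M * h M := by
    intro M
    induction M with
    | zero => simp [hf, shq]
    | succ M ih =>
      rw [Finset.sum_range_succ, ih]
      show _ + (h M + 4 * h (M+1)) * _ = _
      ring
  have hall := seq_all k (J+1) f ?_ ?_ ?_
  · have : ∀ m ≤ J, h m = 0 := by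
      intro m
      induction m with
      | zero =>
        intro _
        have : (0:ℂ) + 4 * h 0 = 0 := hall 0 (by omega)
        simpa using this
      | succ m ih =>
        intro hm
        have : h m + 4 * h (m+1) = 0 := hall (m+1) (by omega)
        rw [ih (by omega)] at this
        simpa using this
    have := this n (by omega)
    simp only [hh] at this
    rwa [if_pos (by omega), show J - n = c by omega] at this
  · have := hD k 0 J
    have e1 := hg 1 J (by omega)
    have e2 := hg 0 (J+1) (by omega)
    have e3 : zwq (gq q) k 0 (J+2) = 0 := by rcases k with _ | k <;> rfl
    simp only [add_zero] at e2
    rw [zero_add, e1, e2, e3] at this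
    push_cast at this ⊢
    linear_combination -this
  · intro n hn
    obtain ⟨c, hc⟩ := Nat.exists_eq_add_of_le hn
    have := hD (k+n+1) (n+1) c
    have e1 := hg (n+2) c (by omega)
    have e2 := hg (n+1) (c+1) (by omega)
    have e3 : zwq (gq q) (k+n+1) (n+1) (c+2) = gq q (k+n) n (c+2) := rfl
    have e4 := hg n (c+2) (by omega)
    have e5 : ((J:ℂ) + 1) = n + 2 + c := by exact_mod_cast hc
    rw [show k+n+1+1 = k + (n+2) by ring, show n+1+1=n+2 by ring, e1, e3, e4,
      show k+n+1 = k+(n+1) by ring, e2] at this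
    push_cast at this ⊢
    rw [e5]
    linear_combination -this
  · rw [hs]; simp [hh]

lemma core (q : ℕ → ℕ → ℕ → ℂ)
    (hD : ∀ a b c : ℕ, ((a:ℂ)+1) * (b+1) * gq q (a+1) (b+1) c + (c+2) * (c+1) * zwq (gq q) a b (c+2)
      - Complex.I * (a - b) * (c+1) * gq q a b (c+1) = 0)
    (N : ℕ) (hN : ∀ a b c, N < a + b + 2 * c → q a b c = 0) (a b c : ℕ)
    (hn : a + b + 2 * c = N) : q a b c = 0 := by
  rcases le_total b a with h | h
  · obtain ⟨k, rfl⟩ := Nat.exists_eq_add_of_le' h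
    exact core_ge q hD N hN k b c hn
  · obtain ⟨k, rfl⟩ := Nat.exists_eq_add_of_le' h
    set q' : ℕ → ℕ → ℕ → ℂ := fun a b c => (starRingEnd ℂ) (q b a c) with hq'
    have hz : ∀ (q : ℕ → ℕ → ℕ → ℂ) a b c,
        zwq (fun a b c => (starRingEnd ℂ) (q b a c)) a b c = (starRingEnd ℂ) (zwq q b a c) := by
      intro q a b c
      rcases a with _ | a <;> rcases b with _ | b <;> simp [zwq]
    have ht : ∀ a b c, ttq q' a b c = (starRingEnd ℂ) (ttq q b a c) := by
      intro a b c
      rcases c with _ | c <;> simp [ttq, hq']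
    have hg : gq q' = fun a b c => (starRingEnd ℂ) (gq q b a c) := by
      funext a b c
      simp only [gq, ht, map_sub, map_mul, map_ofNat]
      rw [hq', hz]
    have := core_ge q' ?_ N ?_ k a c (by omega)
    · simpa [hq'] using this
    · intro a b c
      have h1 := congrArg (starRingEnd ℂ) (hD b a c)
      rw [hg, hz]
      simp only [map_sub, map_add, map_mul, Complex.conj_I, map_natCast, map_one, map_zero, map_ofNat] at h1
      linear_combination h1
    · intro a b c hl
      simp only [hq']
      rw [hN b a c (by omega), map_zero]

abbrev C3 := MvPolynomial (Fin 3) ℂ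

noncomputable def mon (a b c : ℕ) : Fin 3 →₀ ℕ :=
  Finsupp.single 0 a + Finsupp.single 1 b + Finsupp.single 2 c

lemma mon0 (a b c : ℕ) : mon a b c 0 = a := by simp [mon]
lemma mon1 (a b c : ℕ) : mon a b c 1 = b := by simp [mon]
lemma mon2 (a b c : ℕ) : mon a b c 2 = c := by simp [mon]
lemma mon_self (d : Fin 3 →₀ ℕ) : mon (d 0) (d 1) (d 2) = d := by
  ext i; fin_cases i
  · exact mon0 _ _ _
  · exact mon1 _ _ _
  · exact mon2 _ _ _
lemma mon_add0 (a b c : ℕ) : mon a b c + Finsupp.single 0 1 = mon (a+1) b c := by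
  simp only [mon, Finsupp.single_add]; abel
lemma mon_add1 (a b c : ℕ) : mon a b c + Finsupp.single 1 1 = mon a (b+1) c := by
  simp only [mon, Finsupp.single_add]; abel
lemma mon_add2 (a b c : ℕ) : mon a b c + Finsupp.single 2 1 = mon a b (c+1) := by
  simp only [mon, Finsupp.single_add]; abel

noncomputable def cf (p : C3) (a b c : ℕ) : ℂ := coeff (mon a b c) p

lemma cf_d0 (p : C3) (a b c : ℕ) : cf (pderiv 0 p) a b c = (a+1) * cf p (a+1) b c := by
  rw [cf, coeff_pderiv, mon_add0, mon0, cf]; ring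
lemma cf_d1 (p : C3) (a b c : ℕ) : cf (pderiv 1 p) a b c = (b+1) * cf p a (b+1) c := by
  rw [cf, coeff_pderiv, mon_add1, mon1, cf]; ring
lemma cf_d2 (p : C3) (a b c : ℕ) : cf (pderiv 2 p) a b c = (c+1) * cf p a b (c+1) := by
  rw [cf, coeff_pderiv, mon_add2, mon2, cf]; ring
lemma cf_x0 (p : C3) (a b c : ℕ) : cf (X 0 * p) (a+1) b c = cf p a b c := by
  rw [cf, ← mon_add0, add_comm, coeff_X_mul, cf]
lemma cf_x1 (p : C3) (a b c : ℕ) : cf (X 1 * p) a (b+1) c = cf p a b c := by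
  rw [cf, ← mon_add1, add_comm, coeff_X_mul, cf]
lemma cf_x2 (p : C3) (a b c : ℕ) : cf (X 2 * p) a b (c+1) = cf p a b c := by
  rw [cf, ← mon_add2, add_comm, coeff_X_mul, cf]
lemma cf_x0z (p : C3) (b c : ℕ) : cf (X 0 * p) 0 b c = 0 := by
  rw [cf, coeff_X_mul', if_neg]; simp [mon0]
lemma cf_x1z (p : C3) (a c : ℕ) : cf (X 1 * p) a 0 c = 0 := by
  rw [cf, coeff_X_mul', if_neg]; simp [mon1]
lemma cf_x2z (p : C3) (a b : ℕ) : cf (X 2 * p) a b 0 = 0 := by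
  rw [cf, coeff_X_mul', if_neg]; simp [mon2]
lemma cf_add (p q : C3) (a b c : ℕ) : cf (p + q) a b c = cf p a b c + cf q a b c := coeff_add _ _ _
lemma cf_sub (p q : C3) (a b c : ℕ) : cf (p - q) a b c = cf p a b c - cf q a b c := coeff_sub _ _ _ _
lemma cf_C (r : ℂ) (p : C3) (a b c : ℕ) : cf (C r * p) a b c = r * cf p a b c := coeff_C_mul _ _ _

lemma cf_zw (p : C3) (a b c : ℕ) : cf (X 0 * (X 1 * p)) a b c = zwq (cf p) a b c := by
  rcases a with _ | a
  · rw [cf_x0z]; rfl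
  · rw [cf_x0]
    rcases b with _ | b
    · rw [cf_x1z]; rfl
    · rw [cf_x1]; rfl

lemma cf_t (p : C3) (a b c : ℕ) : cf (X 2 * p) a b c = ttq (cf p) a b c := by
  rcases c with _ | c
  · rw [cf_x2z]; rfl
  · rw [cf_x2]; rfl

noncomputable def DC (p : C3) : C3 :=
  pderiv 0 (pderiv 1 p) + X 0 * (X 1 * pderiv 2 (pderiv 2 p))
    - C Complex.I * (X 0 * pderiv 0 (pderiv 2 p) - X 1 * pderiv 1 (pderiv 2 p))

lemma cf_DC (p : C3) (a b c : ℕ) : cf (DC p) a b c =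
   ((a:ℂ)+1) * (b+1) * cf p (a+1) (b+1) c + (c+2) * (c+1) * zwq (cf p) a b (c+2)
      - Complex.I * (a - b) * (c+1) * cf p a b (c+1) := by
  have h0 : cf (X 0 * pderiv 0 (pderiv 2 p)) a b c = a * (c+1) * cf p a b (c+1) := by
    rcases a with _ | a
    · rw [cf_x0z]; simp
    · rw [cf_x0, cf_d0, cf_d2]; push_cast; ring
  have h1 : cf (X 1 * pderiv 1 (pderiv 2 p)) a b c = b * (c+1) * cf p a b (c+1) := by
    rcases b with _ | b
    · rw [cf_x1z]; simp
    · rw [cf_x1, cf_d1, cf_d2]; push_cast; ring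
  have h2 : zwq (cf (pderiv 2 (pderiv 2 p))) a b c = (c+2) * (c+1) * zwq (cf p) a b (c+2) := by
    rcases a with _ | a
    · simp [zwq]
    rcases b with _ | b
    · simp [zwq]
    simp only [zwq, cf_d2]; push_cast; ring
  rw [DC, cf_sub, cf_add, cf_C, cf_sub, h0, h1, cf_zw, h2, cf_d0, cf_d1]
  ring

lemma DC_inj (Q : C3) (h : DC ((1 - X 0 * X 1 - C 4 * X 2) * Q) = 0) : Q = 0 := by
  have hg : cf ((1 - X 0 * X 1 - C 4 * X 2) * Q) = gq (cf Q) := by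
    funext a b c
    rw [show (1 - X 0 * X 1 - C 4 * X 2) * Q = Q - X 0 * (X 1 * Q) - C 4 * (X 2 * Q) by ring,
      cf_sub, cf_sub, cf_C, cf_zw, cf_t, gq]
  have hD : ∀ a b c : ℕ, ((a:ℂ)+1) * (b+1) * gq (cf Q) (a+1) (b+1) c + (c+2) * (c+1) * zwq (gq (cf Q)) a b (c+2)
      - Complex.I * (a - b) * (c+1) * gq (cf Q) a b (c+1) = 0 := by
    intro a b c
    rw [← hg, ← cf_DC, h]; simp [cf]
  by_contra hQ
  obtain ⟨d, hd, hmax⟩ := Finset.exists_max_image Q.support (fun d => d 0 + d 1 + 2 * d 2)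
    (support_nonempty.mpr hQ)
  have := core (cf Q) hD (d 0 + d 1 + 2 * d 2) ?_ (d 0) (d 1) (d 2) rfl
  · rw [cf, mon_self] at this
    exact (mem_support_iff.mp hd) this
  · intro a b c hl
    by_contra hne
    have := hmax (mon a b c) (mem_support_iff.mpr hne)
    rw [mon0, mon1, mon2] at this
    omega

lemma pderiv_swap {K : Type*} [CommRing K] (i j : Fin 3) (p : MvPolynomial (Fin 3) K) :
    pderiv i (pderiv j p) = pderiv j (pderiv i p) := by
  by_cases hij : i = j
  · rw [hij]
  ext d
  simp only [coeff_pderiv]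
  have h1 : (Finsupp.single i 1 : Fin 3 →₀ ℕ) j = 0 := by simp [Finsupp.single_apply, hij]
  have h2 : (Finsupp.single j 1 : Fin 3 →₀ ℕ) i = 0 := by simp [Finsupp.single_apply, Ne.symm hij]
  rw [add_right_comm]
  simp only [Finsupp.add_apply, h1, h2]
  push_cast; ring
noncomputable def Phi : R3 →ₐ[ℝ] C3 :=
  aeval ![C (1/2) * (X 0 + X 1), - C (Complex.I / 2) * (X 0 - X 1), X 2]

noncomputable def Psi : C3 →ₐ[ℂ] C3 :=
  aeval ![X 0 + C Complex.I * X 1, X 0 - C Complex.I * X 1, X 2]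

lemma Phi_inj : Function.Injective Phi := by
  have h : (Psi.restrictScalars ℝ).comp Phi = MvPolynomial.mapAlgHom (Algebra.ofId ℝ ℂ) := by
    apply MvPolynomial.algHom_ext
    intro i
    have hC : ∀ r : ℂ, Psi (C r) = C r := fun r => by simp [Psi]
    have hh : (C (1/2 : ℂ) : C3) * 2 = 1 := by
      rw [show (2 : C3) = C 2 from (map_ofNat C 2).symm, ← C_mul]; norm_num
    have hi : (C (Complex.I/2 : ℂ) : C3) * C Complex.I * 2 = - 1 := by
      rw [show (2 : C3) = C 2 from (map_ofNat C 2).symm, ← C_mul, ← C_mul,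
        show Complex.I / 2 * Complex.I * 2 = -1 by linear_combination Complex.I_mul_I]; simp
    have h0 : Psi (X 0) = X 0 + C Complex.I * X 1 := by simp [Psi]
    have h1 : Psi (X 1) = X 0 - C Complex.I * X 1 := by simp [Psi]
    have h2 : Psi (X 2) = X 2 := by simp [Psi]
    fin_cases i
    · show Psi (Phi (X 0)) = mapAlgHom _ (X 0)
      have : Phi (X 0) = C (1/2) * (X 0 + X 1) := by simp [Phi]
      rw [this, map_mul, map_add, hC, h0, h1, mapAlgHom_apply, map_X]
      linear_combination (X 0) * hh
    · show Psi (Phi (X 1)) = mapAlgHom _ (X 1)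
      have : Phi (X 1) = - C (Complex.I/2) * (X 0 - X 1) := by simp [Phi]
      rw [this, map_mul, map_neg, map_sub, hC, h0, h1, mapAlgHom_apply, map_X]
      linear_combination (-X 1) * hi
    · show Psi (Phi (X 2)) = mapAlgHom _ (X 2)
      have : Phi (X 2) = X 2 := by simp [Phi]
      rw [this, h2]; simp
  have h2 : Function.Injective (⇑Psi ∘ ⇑Phi) := by
    have : (⇑Psi ∘ ⇑Phi) = ⇑(MvPolynomial.mapAlgHom (σ := Fin 3) (Algebra.ofId ℝ ℂ)) := by
      funext p; exact DFunLike.congr_fun h p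
    rw [this]
    exact MvPolynomial.map_injective _ (algebraMap ℝ ℂ).injective
  exact h2.of_comp

lemma Phi_X0 : Phi (X 0) = C (1/2) * (X 0 + X 1) := by simp [Phi]
lemma Phi_X1 : Phi (X 1) = - C (Complex.I / 2) * (X 0 - X 1) := by simp [Phi]
lemma Phi_X2 : Phi (X 2) = X 2 := by simp [Phi]

lemma Phi_der (D : Derivation ℝ R3 R3) (E : Derivation ℂ C3 C3)
    (h : ∀ i, Phi (D (X i)) = E (Phi (X i))) (p : R3) : Phi (D p) = E (Phi p) := by
  induction p using MvPolynomial.induction_on with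
  | C a =>
    have h1 : D (C a) = 0 := D.map_algebraMap a
    have h2 : Phi (C a) = algebraMap ℂ C3 (a : ℂ) := by
      rw [Phi, aeval_C]; rfl
    rw [h1, h2, E.map_algebraMap, map_zero]
  | add p q hp hq => simp only [map_add, hp, hq]
  | mul_X p i hp =>
    simp only [Derivation.leibniz, map_mul, map_add, smul_eq_mul, hp, h]

lemma C2mul : (2 : C3) = C 2 := (map_ofNat C 2).symm
lemma hhalf : (C (1/2 : ℂ) : C3) * 2 = 1 := by
  rw [C2mul, ← C_mul]; norm_num
lemma hIhalf : (C (Complex.I/2 : ℂ) : C3) = C Complex.I * C (1/2) := by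
  rw [← C_mul]; congr 1; ring
lemma hII : (C Complex.I : C3) * C Complex.I = -1 := by
  rw [← C_mul, Complex.I_mul_I]; simp

lemma Phi_d0 (p : R3) : Phi (pderiv 0 p) = pderiv 0 (Phi p) + pderiv 1 (Phi p) := by
  refine Phi_der (pderiv 0) (pderiv 0 + pderiv 1) ?_ p
  intro i
  fin_cases i
  · show Phi (pderiv 0 (X 0)) = pderiv 0 (Phi (X 0)) + pderiv 1 (Phi (X 0))
    rw [Phi_X0]
    simp [pderiv_mul, pderiv_X, Pi.single_apply]
    have h := hhalf
    rw [one_div] at h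
    linear_combination - h
  · show Phi (pderiv 0 (X 1)) = pderiv 0 (Phi (X 1)) + pderiv 1 (Phi (X 1))
    rw [Phi_X1]
    simp [pderiv_mul, pderiv_X, Pi.single_apply]
  · show Phi (pderiv 0 (X 2)) = pderiv 0 (Phi (X 2)) + pderiv 1 (Phi (X 2))
    rw [Phi_X2]
    simp [pderiv_X, Pi.single_apply]

lemma Phi_d1 (p : R3) : Phi (pderiv 1 p) = C Complex.I * (pderiv 0 (Phi p) - pderiv 1 (Phi p)) := by
  have := Phi_der (pderiv 1) ((C Complex.I : C3) • (pderiv 0 - pderiv 1)) ?_ p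
  · exact this
  intro i
  fin_cases i
  · show Phi (pderiv 1 (X 0)) = C Complex.I * (pderiv 0 (Phi (X 0)) - pderiv 1 (Phi (X 0)))
    rw [Phi_X0]
    simp [pderiv_mul, pderiv_X, Pi.single_apply]
  · show Phi (pderiv 1 (X 1)) = C Complex.I * (pderiv 0 (Phi (X 1)) - pderiv 1 (Phi (X 1)))
    rw [Phi_X1, hIhalf]
    have h := hhalf
    simp only [pderiv_mul, pderiv_X, map_neg, map_sub, pderiv_C, Pi.single_apply]
    simp only [Pi.single_eq_same, map_one, if_true, one_ne_zero, if_false, zero_ne_one]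
    simp only [zero_mul, mul_zero, neg_zero, zero_add, add_zero]
    linear_combination (-1 : C3) * h + 2 * C (1/2) * hII
  · show Phi (pderiv 1 (X 2)) = C Complex.I * (pderiv 0 (Phi (X 2)) - pderiv 1 (Phi (X 2)))
    rw [Phi_X2]
    simp [pderiv_X, Pi.single_apply]

lemma Phi_d2 (p : R3) : Phi (pderiv 2 p) = pderiv 2 (Phi p) := by
  refine Phi_der (pderiv 2) (pderiv 2) ?_ p
  intro i
  fin_cases i
  · show Phi (pderiv 2 (X 0)) = pderiv 2 (Phi (X 0))
    rw [Phi_X0]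
    simp [pderiv_mul, pderiv_X, Pi.single_apply]
  · show Phi (pderiv 2 (X 1)) = pderiv 2 (Phi (X 1))
    rw [Phi_X1]
    simp [pderiv_mul, pderiv_X, Pi.single_apply]
  · show Phi (pderiv 2 (X 2)) = pderiv 2 (Phi (X 2))
    rw [Phi_X2]
    simp [pderiv_X, Pi.single_apply]

lemma Xop_apply (p : R3) : Xop p = pderiv 0 p + 2 * X 1 * pderiv 2 p := rfl
lemma Yop_apply (p : R3) : Yop p = pderiv 1 p - 2 * X 0 * pderiv 2 p := rfl

lemma ΔH_apply (p : R3) : ΔH p = pderiv 0 (pderiv 0 p) + pderiv 1 (pderiv 1 p)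
    + 4 * (X 1 * (pderiv 0 (pderiv 2 p)) - X 0 * pderiv 1 (pderiv 2 p))
    + 4 * (X 0 * X 0 + X 1 * X 1) * pderiv 2 (pderiv 2 p) := by
  show Xop (Xop p) + Yop (Yop p) = _
  have h2 : ∀ i, pderiv (R := ℝ) (σ := Fin 3) i 2 = 0 := fun i => by
    rw [show (2 : R3) = C 2 from (map_ofNat C 2).symm, pderiv_C]
  simp only [Xop_apply, Yop_apply, map_add, map_sub, pderiv_mul, h2, pderiv_X, Pi.single_apply]
  rw [pderiv_swap 2 0 p, pderiv_swap 2 1 p]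
  simp
  ring

lemma Phi_ΔH (p : R3) : Phi (ΔH p) = 4 * DC (Phi p) := by
  have hh := hhalf
  have hI := hII
  rw [ΔH_apply, DC]
  simp only [map_add, map_sub, map_mul, Phi_d0, Phi_d1, Phi_d2, Phi_X0, Phi_X1, hIhalf, pderiv_C_mul]
  rw [show Phi 4 = 4 from map_ofNat Phi 4, pderiv_swap 1 0]
  generalize pderiv 0 (pderiv 0 (Phi p)) = u00
  generalize pderiv 1 (pderiv 1 (Phi p)) = u11
  generalize pderiv 0 (pderiv 1 (Phi p)) = u01
  generalize pderiv 0 (pderiv 2 (Phi p)) = u02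
  generalize pderiv 1 (pderiv 2 (Phi p)) = u12
  generalize pderiv 2 (pderiv 2 (Phi p)) = u22
  generalize (X 0 : C3) = z
  generalize (X 1 : C3) = w
  generalize (C (1/2) : C3) = h at *
  generalize (C Complex.I : C3) = i at *
  grind

lemma Phi_eta : Phi (1 - etaSq) = 1 - X 0 * X 1 - C 4 * X 2 := by
  have hh := hhalf
  have hI := hII
  rw [etaSq]
  simp only [map_add, map_sub, map_mul, map_pow, map_one, Phi_X0, Phi_X1, Phi_X2, hIhalf]
  rw [show Phi 4 = 4 from map_ofNat Phi 4, show (C 4 : C3) = 4 from map_ofNat C 4]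
  generalize (C (1/2) : C3) = h at *
  generalize (C Complex.I : C3) = i at *
  grind

lemma ΔH_inj (q : R3) (h : ΔH ((1 - etaSq) * q) = 0) : q = 0 := by
  apply Phi_inj
  rw [map_zero]
  apply DC_inj
  have := Phi_ΔH ((1 - etaSq) * q)
  rw [h, map_zero, map_mul, Phi_eta] at this
  have h4 : (4 : C3) ≠ 0 := by norm_num
  exact (mul_eq_zero.mp this.symm).resolve_left h4

/-! degree filtration -/
def wt (d : Fin 3 →₀ ℕ) : ℤ := (d 0 : ℤ) + (d 1 : ℤ) + 2 * (d 2 : ℤ)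

noncomputable def VV (N : ℤ) : Submodule ℝ R3 := restrictSupport ℝ {d | wt d ≤ N}

lemma mem_VV {N : ℤ} {p : R3} : p ∈ VV N ↔ ∀ d, N < wt d → coeff d p = 0 := by
  rw [VV, mem_restrictSupport_iff]
  constructor
  · intro h d hd
    by_contra hc
    have : wt d ≤ N := h (mem_support_iff.mpr hc)
    omega
  · intro h d hd
    by_contra hc
    exact mem_support_iff.mp hd (h d (not_le.mp hc))

instance VV_fin (N : ℤ) : FiniteDimensional ℝ (VV N) := by
  have hfin : ({d | wt d ≤ N} : Set (Fin 3 →₀ ℕ)).Finite := by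
    apply (Set.finite_Iic (Finsupp.equivFunOnFinite.symm (fun _ => N.toNat) : Fin 3 →₀ ℕ)).subset
    intro d hd
    have hd : wt d ≤ N := hd
    unfold wt at hd
    rw [Set.mem_Iic]
    intro i
    show d i ≤ N.toNat
    fin_cases i
    · show d 0 ≤ _; omega
    · show d 1 ≤ _; omega
    · show d 2 ≤ _; omega
  have : Finite ({d | wt d ≤ N} : Set (Fin 3 →₀ ℕ)) := hfin
  exact Module.Finite.of_basis (basisRestrictSupport ℝ {d | wt d ≤ N})

lemma VV_mono {N M : ℤ} (h : N ≤ M) {p : R3} (hp : p ∈ VV N) : p ∈ VV M :=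
  mem_VV.mpr (fun d hd => mem_VV.mp hp d (by omega))

lemma wt_single (i : Fin 3) : wt (Finsupp.single i 1) = w3 i := by
  fin_cases i <;> simp [wt, w3]

lemma wt_add (d e) : wt (d + e) = wt d + wt e := by
  simp only [wt, Finsupp.add_apply]; push_cast; ring

lemma VV_d {N : ℤ} (i : Fin 3) {p : R3} (hp : p ∈ VV N) : pderiv i p ∈ VV (N - w3 i) := by
  rw [mem_VV] at *
  intro d hd
  rw [coeff_pderiv, hp, zero_mul]
  rw [wt_add, wt_single]; omega

lemma VV_X {N : ℤ} (i : Fin 3) {p : R3} (hp : p ∈ VV N) : X i * p ∈ VV (N + w3 i) := by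
  rw [mem_VV] at *
  intro d hd
  rw [coeff_X_mul']
  split_ifs with h
  · apply hp
    have h1 : d - Finsupp.single i 1 + Finsupp.single i 1 = d := by
      apply tsub_add_cancel_of_le
      rw [Finsupp.single_le_iff]
      exact Nat.one_le_iff_ne_zero.mpr (Finsupp.mem_support_iff.mp h)
    have h2 := wt_add (d - Finsupp.single i 1) (Finsupp.single i 1)
    rw [h1, wt_single] at h2
    omega
  · rfl

lemma VV_4 {N : ℤ} {p : R3} (hp : p ∈ VV N) : 4 * p ∈ VV N := by
  rw [show 4 * p = (4:ℝ) • p by rw [smul_eq_C_mul, show (C 4 : R3) = 4 from map_ofNat C 4]]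
  exact Submodule.smul_mem _ _ hp

lemma w30 : w3 0 = 1 := rfl
lemma w31 : w3 1 = 1 := rfl
lemma w32 : w3 2 = 2 := rfl

lemma VV_ΔH {N : ℤ} {p : R3} (hp : p ∈ VV N) : ΔH p ∈ VV (N - 2) := by
  have e : ∀ {M : ℤ} {p : R3}, p ∈ VV M → M = N - 2 → p ∈ VV (N-2) := fun h e => e ▸ h
  rw [ΔH_apply]
  rw [show (4 * (X 0 * X 0 + X 1 * X 1) * pderiv 2 (pderiv 2 p) : R3) =
    4 * (X 0 * (X 0 * pderiv 2 (pderiv 2 p)) + X 1 * (X 1 * pderiv 2 (pderiv 2 p))) by ring]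
  have w0 := w30
  have w1 := w31
  have w2 := w32
  refine Submodule.add_mem _ (Submodule.add_mem _ (Submodule.add_mem _ ?_ ?_) (VV_4 (Submodule.sub_mem _ ?_ ?_)))
    (VV_4 (Submodule.add_mem _ ?_ ?_))
  · exact e (VV_d 0 (VV_d 0 hp)) (by omega)
  · exact e (VV_d 1 (VV_d 1 hp)) (by omega)
  · exact e (VV_X 1 (VV_d 0 (VV_d 2 hp))) (by omega)
  · exact e (VV_X 0 (VV_d 1 (VV_d 2 hp))) (by omega)
  · exact e (VV_X 0 (VV_X 0 (VV_d 2 (VV_d 2 hp)))) (by omega)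
  · exact e (VV_X 1 (VV_X 1 (VV_d 2 (VV_d 2 hp)))) (by omega)

lemma VV_eta {N : ℤ} {p : R3} (hp : p ∈ VV N) : (1 - etaSq) * p ∈ VV (N + 2) := by
  have e : ∀ {M : ℤ} {p : R3}, p ∈ VV M → M = N + 2 → p ∈ VV (N+2) := fun h e => e ▸ h
  rw [etaSq, show ((1 - (X 0 ^ 2 + X 1 ^ 2 + 4 * X 2)) * p : R3) =
    p - (X 0 * (X 0 * p) + X 1 * (X 1 * p) + 4 * (X 2 * p)) by ring]
  have w0 := w30
  have w1 := w31
  have w2 := w32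
  refine Submodule.sub_mem _ (VV_mono (by omega) hp) (Submodule.add_mem _ (Submodule.add_mem _ ?_ ?_) (VV_4 ?_))
  · exact e (VV_X 0 (VV_X 0 hp)) (by omega)
  · exact e (VV_X 1 (VV_X 1 hp)) (by omega)
  · exact e (VV_X 2 hp) (by omega)

lemma VV_T {N : ℤ} {p : R3} (hp : p ∈ VV N) : ΔH ((1 - etaSq) * p) ∈ VV N := by
  have := VV_ΔH (VV_eta hp)
  rwa [add_sub_cancel_right] at this

lemma Pm_VV (m : ℤ) (p : R3) (hp : p ∈ Pm m) : p ∈ VV m := by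
  rw [mem_VV]
  intro d hd
  by_contra hc
  have h := (mem_weightedHomogeneousSubmodule ℝ w3 m p).mp hp hc
  have : Finsupp.weight w3 d = wt d := by
    rw [Finsupp.weight_apply, Finsupp.sum_fintype _ _ (by simp), Fin.sum_univ_three]
    simp [w30, w31, w32, wt]; ring
  omega

/-- for every `p ∈ P_m` there is a polynomial `q`, all of whose monomials
have weighted degree at most `m − 2` (so `q = 0` when `m ≤ 1`), with
`Δ_H((1 − η₊²) q) = −Δ_H p`. -/
theorem stmt2 (m : ℕ) (p : R3) (hp : p ∈ Pm (m : ℤ)) :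
    ∃ q : R3,
      (∀ d ∈ q.support, (d 0 : ℤ) + (d 1 : ℤ) + 2 * (d 2 : ℤ) ≤ (m : ℤ) - 2) ∧
      ΔH ((1 - etaSq) * q) = -ΔH p := by
  let T : R3 →ₗ[ℝ] R3 := ΔH ∘ₗ LinearMap.mulLeft ℝ (1 - etaSq)
  have hT : ∀ q ∈ VV ((m:ℤ) - 2), T q ∈ VV ((m:ℤ) - 2) := fun q hq => VV_T hq
  have hinj : Function.Injective (T.restrict hT) := by
    rw [injective_iff_map_eq_zero]
    intro q hq
    apply Subtype.ext
    exact ΔH_inj q.1 (congrArg Subtype.val hq)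
  obtain ⟨q, hq⟩ := LinearMap.injective_iff_surjective.mp hinj
    ⟨-ΔH p, Submodule.neg_mem _ (VV_ΔH (Pm_VV m p hp))⟩
  refine ⟨q.1, ?_, congrArg Subtype.val hq⟩
  intro d hd
  by_contra hc
  exact mem_support_iff.mp hd (mem_VV.mp q.2 d (not_le.mp hc))

end
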